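/- For the linear manipulation technology with interest rate r ≥ 0, the value function of the manipulation stage of any contract is itself manipulation-proof: for every contract Y with 0 ≤ Y(w) ≤ M for all w ∈ [0, M], the function V satisfies V(w) − g(w − x) ≤ V(x) for all x, w ∈ [0, M]; consequently, sup_{w ∈ [0, M]} (V(w) − g(w − x)) = V(x) for every x ∈ [0, M]. -/

import Mathlib

/-- The linear manipulation technology with interest rate `r`:
`g(z) = (1 + r) · max{0, z}`. -/
noncomputable def linearTech (r : ℝ) (z : ℝ) : ℝ := (1 + r) * max 0 z

/-- Value function of the manipulation stage:
`V(x) = sup_{w ∈ [0, M]} (Y(w) − g(w − x))`. -/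
noncomputable def valueFun (M : ℝ) (g Y : ℝ → ℝ) (x : ℝ) : ℝ :=
  sSup ((fun w => Y w - g (w - x)) '' Set.Icc 0 M)

theorem linearTech_nonneg {r : ℝ} (hr : 0 ≤ r) (z : ℝ) : 0 ≤ linearTech r z :=
  mul_nonneg (by linarith) (le_max_left 0 z)

/-- The linear technology is subadditive. -/
theorem linearTech_add_le {r : ℝ} (hr : 0 ≤ r) (a b : ℝ) :
    linearTech r (a + b) ≤ linearTech r a + linearTech r b := by
  unfold linearTech
  rw [← mul_add]
  refine mul_le_mul_of_nonneg_left (max_le ?_ ?_) (by linarith)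
  · exact add_nonneg (le_max_left 0 a) (le_max_left 0 b)
  · exact add_le_add (le_max_right 0 a) (le_max_right 0 b)

theorem le_valueFun_linearTech {M r : ℝ} (hr : 0 ≤ r) {Y : ℝ → ℝ}
    (hY : ∀ w ∈ Set.Icc (0 : ℝ) M, Y w ≤ M) (x : ℝ) {w : ℝ} (hw : w ∈ Set.Icc (0 : ℝ) M) :
    Y w - linearTech r (w - x) ≤ valueFun M (linearTech r) Y x := by
  refine le_csSup ⟨M, ?_⟩ (Set.mem_image_of_mem _ hw)
  rintro _ ⟨v, hv, rfl⟩
  exact (sub_le_self _ (linearTech_nonneg hr _)).trans (hY v hv)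

/-- The value function of the manipulation stage is manipulation-proof. -/
theorem valueFun_linearTech_sub_le {M r : ℝ} (hM : 0 ≤ M) (hr : 0 ≤ r) {Y : ℝ → ℝ}
    (hY : ∀ w ∈ Set.Icc (0 : ℝ) M, Y w ≤ M) (x w : ℝ) :
    valueFun M (linearTech r) Y w - linearTech r (w - x) ≤ valueFun M (linearTech r) Y x := by
  rw [sub_le_iff_le_add]
  refine csSup_le ((Set.nonempty_Icc.2 hM).image _) ?_
  rintro _ ⟨v, hv, rfl⟩
  have h₁ := le_valueFun_linearTech hr hY x hv
  have h₂ := linearTech_add_le hr (v - w) (w - x)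
  rw [sub_add_sub_cancel] at h₂
  dsimp only
  linarith

/-- for the linear manipulation technology, the value function of
the manipulation stage of any contract is itself manipulation-proof, and hence
is a fixed point of the value-function operator. -/
theorem value_function_manipulation_proof
    (M : ℝ) (hM : 0 < M) (r : ℝ) (hr : 0 ≤ r)
    (Y : ℝ → ℝ) (hY : ∀ w ∈ Set.Icc (0 : ℝ) M, 0 ≤ Y w ∧ Y w ≤ M) :
    (∀ x ∈ Set.Icc (0 : ℝ) M, ∀ w ∈ Set.Icc (0 : ℝ) M,
      valueFun M (linearTech r) Y w - linearTech r (w - x) ≤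
        valueFun M (linearTech r) Y x) ∧
    (∀ x ∈ Set.Icc (0 : ℝ) M,
      sSup ((fun w => valueFun M (linearTech r) Y w - linearTech r (w - x)) ''
          Set.Icc 0 M) = valueFun M (linearTech r) Y x) := by
  have hYM : ∀ w ∈ Set.Icc (0 : ℝ) M, Y w ≤ M := fun w hw => (hY w hw).2
  refine ⟨fun x _ w _ => valueFun_linearTech_sub_le hM.le hr hYM x w, fun x hx => ?_⟩
  refine IsGreatest.csSup_eq ⟨⟨x, hx, ?_⟩, ?_⟩
  · simp [linearTech]
  · rintro _ ⟨w, -, rfl⟩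
    exact valueFun_linearTech_sub_le hM.le hr hYM x w
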